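/- arXiv:1504.03314 — 5 statements merged into one kernel-verified Lean document; each statement's English description precedes it below -/
import Mathlib

section
/- There are exactly 406 maps R : (ZMod 2)³ → (ZMod 2)³ satisfying the set-theoretic tetrahedron equation R₁₂₃ ∘ R₁₄₅ ∘ R₂₄₆ ∘ R₃₅₆ = R₃₅₆ ∘ R₂₄₆ ∘ R₁₄₅ ∘ R₁₂₃ as maps (ZMod 2)⁶ → (ZMod 2)⁶. -/
/-- `R` acting on coordinates 1, 2, 3 of `X⁶`. -/
def act123 {X : Type*} (R : X × X × X → X × X × X) :
    X × X × X × X × X × X → X × X × X × X × X × X := fun p =>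
  let q := R (p.1, p.2.1, p.2.2.1)
  (q.1, q.2.1, q.2.2, p.2.2.2.1, p.2.2.2.2.1, p.2.2.2.2.2)

/-- `R` acting on coordinates 1, 4, 5 of `X⁶`. -/
def act145 {X : Type*} (R : X × X × X → X × X × X) :
    X × X × X × X × X × X → X × X × X × X × X × X := fun p =>
  let q := R (p.1, p.2.2.2.1, p.2.2.2.2.1)
  (q.1, p.2.1, p.2.2.1, q.2.1, q.2.2, p.2.2.2.2.2)

/-- `R` acting on coordinates 2, 4, 6 of `X⁶`. -/
def act246 {X : Type*} (R : X × X × X → X × X × X) :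
    X × X × X × X × X × X → X × X × X × X × X × X := fun p =>
  let q := R (p.2.1, p.2.2.2.1, p.2.2.2.2.2)
  (p.1, q.1, p.2.2.1, q.2.1, p.2.2.2.2.1, q.2.2)

/-- `R` acting on coordinates 3, 5, 6 of `X⁶`. -/
def act356 {X : Type*} (R : X × X × X → X × X × X) :
    X × X × X × X × X × X → X × X × X × X × X × X := fun p =>
  let q := R (p.2.2.1, p.2.2.2.2.1, p.2.2.2.2.2)
  (p.1, p.2.1, q.1, p.2.2.2.1, q.2.1, q.2.2)

/-- The set-theoretic tetrahedron equation. -/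
def STTE {X : Type*} (R : X × X × X → X × X × X) : Prop :=
  act123 R ∘ act145 R ∘ act246 R ∘ act356 R =
    act356 R ∘ act246 R ∘ act145 R ∘ act123 R

namespace Tetrahedron

/-! ### Transport along a bijection -/

/-- The bijection of cubes induced by a bijection of sets. -/
def cubeEquiv {X Y : Type*} (e : X ≃ Y) : X × X × X ≃ Y × Y × Y :=
  e.prodCongr (e.prodCongr e)

/-- The bijection of sixth powers induced by a bijection of sets. -/
def sixthEquiv {X Y : Type*} (e : X ≃ Y) :
    X × X × X × X × X × X ≃ Y × Y × Y × Y × Y × Y :=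
  e.prodCongr (e.prodCongr (e.prodCongr (cubeEquiv e)))

theorem stte_conj {X Y : Type*} (e : X ≃ Y) (R : X × X × X → X × X × X) :
    STTE ((cubeEquiv e).arrowCongr (cubeEquiv e) R) ↔ STTE R := by
  have h123 : act123 ((cubeEquiv e).arrowCongr (cubeEquiv e) R) =
      (sixthEquiv e).arrowCongr (sixthEquiv e) (act123 R) := by
    funext ⟨x₁, x₂, x₃, x₄, x₅, x₆⟩; simp [act123, cubeEquiv, sixthEquiv]
  have h145 : act145 ((cubeEquiv e).arrowCongr (cubeEquiv e) R) =
      (sixthEquiv e).arrowCongr (sixthEquiv e) (act145 R) := by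
    funext ⟨x₁, x₂, x₃, x₄, x₅, x₆⟩; simp [act145, cubeEquiv, sixthEquiv]
  have h246 : act246 ((cubeEquiv e).arrowCongr (cubeEquiv e) R) =
      (sixthEquiv e).arrowCongr (sixthEquiv e) (act246 R) := by
    funext ⟨x₁, x₂, x₃, x₄, x₅, x₆⟩; simp [act246, cubeEquiv, sixthEquiv]
  have h356 : act356 ((cubeEquiv e).arrowCongr (cubeEquiv e) R) =
      (sixthEquiv e).arrowCongr (sixthEquiv e) (act356 R) := by
    funext ⟨x₁, x₂, x₃, x₄, x₅, x₆⟩; simp [act356, cubeEquiv, sixthEquiv]; rfl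
  simp only [STTE, h123, h145, h246, h356, ← Equiv.arrowCongr_comp]
  exact ((sixthEquiv e).arrowCongr (sixthEquiv e)).injective.eq_iff

/-! ### Tables of Boolean maps -/

/-- The three coordinates of the value of a map. -/
inductive Coord
  | fst
  | snd
  | thd
  deriving DecidableEq

instance : Fintype Coord :=
  ⟨{.fst, .snd, .thd}, fun c => by cases c <;> decide⟩

/-- A bit of the value table of a map `Bool³ → Bool³`. -/
abbrev Cell := Coord × Bool × Bool × Bool

/-- The maps `Bool³ → Bool³` are the same as their value tables. -/
def tableEquiv : (Cell → Bool) ≃ (Bool × Bool × Bool → Bool × Bool × Bool) where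
  toFun F p := (F (.fst, p), F (.snd, p), F (.thd, p))
  invFun R i := match i with
    | (.fst, p) => (R p).1
    | (.snd, p) => (R p).2.1
    | (.thd, p) => (R p).2.2
  left_inv F := by funext ⟨c, p⟩; cases c <;> rfl
  right_inv R := rfl

/-! ### Partial tables -/

/-- The component of a pair selected by a bit. -/
noncomputable def sel {α : Type} (p : α × α) (x : Bool) : α :=
  Bool.rec p.1 p.2 x

/-- Modify the component of a pair selected by a bit. -/
def upd {α : Type} (p : α × α) (x : Bool) (f : α → α) : α × α :=
  match x with
  | false => (f p.1, p.2)
  | true => (p.1, f p.2)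

/-- A partially known Boolean function of three bits. -/
abbrev PartialFun :=
  ((Option Bool × Option Bool) × (Option Bool × Option Bool)) ×
    ((Option Bool × Option Bool) × (Option Bool × Option Bool))

theorem sel_upd (q : PartialFun) (x y z x' y' z' : Bool) (o : Option Bool) :
    sel (sel (sel (upd q x fun q => upd q y fun q => upd q z fun _ => o) x') y') z' =
      if x' = x ∧ y' = y ∧ z' = z then o else sel (sel (sel q x') y') z' := by
  cases x <;> cases x' <;> cases y <;> cases y' <;> cases z <;> cases z' <;> rfl

/-- A partially known value table. -/
structure PartialTable where
  /-- The first coordinate. -/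
  fst : PartialFun
  /-- The second coordinate. -/
  snd : PartialFun
  /-- The third coordinate. -/
  thd : PartialFun

namespace PartialTable

/-- The coordinate functions of a partial table. -/
noncomputable def coord (t : PartialTable) (c : Coord) : PartialFun :=
  Coord.rec t.fst t.snd t.thd c

/-- The entry of a partial table at a cell. -/
noncomputable def look (t : PartialTable) (c : Coord) (x y z : Bool) : Option Bool :=
  sel (sel (sel (t.coord c) x) y) z

/-- Enter a value at a cell. -/
noncomputable def enter (t : PartialTable) (c : Coord) (x y z b : Bool) : PartialTable :=
  let f := fun q : PartialFun => upd q x fun q => upd q y fun q => upd q z fun _ => some b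
  match c with
  | .fst => ⟨f t.fst, t.snd, t.thd⟩
  | .snd => ⟨t.fst, f t.snd, t.thd⟩
  | .thd => ⟨t.fst, t.snd, f t.thd⟩

theorem look_enter (t : PartialTable) (c c' : Coord) (x y z b x' y' z' : Bool) :
    (t.enter c x y z b).look c' x' y' z' =
      if (c', x', y', z') = (c, x, y, z) then some b else t.look c' x' y' z' := by
  cases c <;> cases c' <;>
    simp only [look, enter, coord, sel_upd, Prod.mk.injEq, reduceCtorEq, true_and, false_and,
      if_false]

/-- The values allowed by an entry. -/
def choices : Option Bool → Finset Bool
  | none => Finset.univ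
  | some b => {b}

/-- The value tables extending a partial table. -/
noncomputable def extensions (t : PartialTable) : Finset (Cell → Bool) :=
  Fintype.piFinset fun i => choices (t.look i.1 i.2.1 i.2.2.1 i.2.2.2)

theorem mem_extensions {t : PartialTable} {F : Cell → Bool} :
    F ∈ t.extensions ↔ ∀ c x y z, F (c, x, y, z) ∈ choices (t.look c x y z) := by
  simp [extensions, Fintype.mem_piFinset]

theorem mem_extensions_enter {t : PartialTable} {c : Coord} {x y z b : Bool} {F : Cell → Bool}
    (h : t.look c x y z = none) :
    F ∈ (t.enter c x y z b).extensions ↔ F ∈ t.extensions ∧ F (c, x, y, z) = b := by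
  simp only [mem_extensions, look_enter]
  constructor
  · intro H
    have hb : F (c, x, y, z) = b := by simpa [choices] using H c x y z
    refine ⟨fun c' x' y' z' => ?_, hb⟩
    by_cases hi : (c', x', y', z') = (c, x, y, z)
    · simp only [Prod.mk.injEq] at hi
      obtain ⟨rfl, rfl, rfl, rfl⟩ := hi
      simp [h, choices]
    · simpa only [if_neg hi] using H c' x' y' z'
  · rintro ⟨H, hb⟩ c' x' y' z'
    split_ifs with hi
    · simp [hi, hb, choices]
    · exact H c' x' y' z'

/-- The number of values allowed by an entry. -/
def weight : Option Bool → ℕ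
  | none => 2
  | some _ => 1

/-- The number of extensions of a partially known function. -/
def funWeight (q : PartialFun) : ℕ :=
  weight q.1.1.1 * weight q.1.1.2 * (weight q.1.2.1 * weight q.1.2.2) *
    (weight q.2.1.1 * weight q.2.1.2 * (weight q.2.2.1 * weight q.2.2.2))

/-- The number of extensions of a partial table. -/
def size (t : PartialTable) : ℕ :=
  funWeight t.fst * funWeight t.snd * funWeight t.thd

theorem card_extensions (t : PartialTable) : t.extensions.card = t.size := by
  have hw : ∀ o, (choices o).card = weight o := by rintro (_ | _) <;> rfl
  have hc : ∀ f : Coord → ℕ, ∏ c, f c = f .fst * f .snd * f .thd := fun f => by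
    have : (Finset.univ : Finset Coord) = {.fst, .snd, .thd} := rfl
    simp [this, mul_assoc]
  simp only [extensions, Fintype.card_piFinset, hw, Fintype.prod_prod_type, hc,
    Fintype.prod_bool, size, funWeight, look, coord, sel]
  ring

/-- The table without any entry. -/
def blank : PartialTable :=
  let q : PartialFun :=
    (((none, none), (none, none)), ((none, none), (none, none)))
  ⟨q, q, q⟩

theorem extensions_blank : blank.extensions = Finset.univ := by
  ext F
  have : ∀ c x y z, blank.look c x y z = none := by decide
  simp [mem_extensions, this, choices]

end PartialTable

/-! ### Counting by lazy evaluation -/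

/-- Continue with the pair in which the component selected by a bit is modified. As opposed to
`upd`, this keeps pairs in normal form during evaluation. -/
def updThen {α : Type} (p : α × α) (x : Bool) (f : α → (α → ℕ) → ℕ) (k : α × α → ℕ) : ℕ :=
  Prod.casesOn p fun a b =>
    Bool.casesOn x (f a fun a' => k (a', b)) (f b fun b' => k (a, b'))

/-- Continue with the partial table in which a value is entered at a cell. -/
def enterThen (t : PartialTable) (c : Coord) (x y z b : Bool) (k : PartialTable → ℕ) : ℕ :=
  let f : PartialFun → (PartialFun → ℕ) → ℕ := fun q =>
    updThen q x fun q => updThen q y fun q => updThen q z fun _ k => k (some b)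
  PartialTable.casesOn t fun q r s => Coord.casesOn c
    (f q fun q' => k ⟨q', r, s⟩) (f r fun r' => k ⟨q, r', s⟩) (f s fun s' => k ⟨q, r, s'⟩)

theorem enterThen_eq (t : PartialTable) (c : Coord) (x y z b : Bool) (k : PartialTable → ℕ) :
    enterThen t c x y z b k = k (t.enter c x y z b) := by
  cases c <;> cases x <;> cases y <;> cases z <;> rfl

/-- A procedure turning a partial table into the number of its extensions with some property. -/
abbrev Counter := PartialTable → ℕ

/-- Run a counter for both values at a cell. -/
def branch (c : Coord) (x y z : Bool) (k : Bool → Counter) : Counter := fun t =>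
  enterThen t c x y z false (k false) + enterThen t c x y z true (k true)

/-- Query a cell, branching if its value is unknown. -/
noncomputable def ask (c : Coord) (x y z : Bool) (k : Bool → Counter) : Counter := fun t =>
  Option.rec (branch c x y z k t) (fun b => k b t) (t.look c x y z)

/-- Return zero unless two bits agree. -/
noncomputable def same (x y : Bool) (k : Counter) : Counter := fun t =>
  Bool.rec (Bool.rec (k t) 0 y) (Bool.rec 0 (k t) y) x

/-- The counter `k` counts the extensions with the property `P`. -/
def Counts (k : Counter) (P : (Cell → Bool) → Prop) : Prop :=
  ∀ t, k t = {F | F ∈ t.extensions ∧ P F}.ncard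

theorem counts_size : Counts PartialTable.size fun _ => True := fun t => by
  simp only [and_true, Finset.setOfPred_mem, Set.ncard_coe_finset, PartialTable.card_extensions]

theorem Counts.ask {c : Coord} {x y z : Bool} {k : Bool → Counter}
    {P : Bool → (Cell → Bool) → Prop} (hk : ∀ b, Counts (k b) (P b)) :
    Counts (ask c x y z k) fun F => P (F (c, x, y, z)) F := fun t => by
  cases h : t.look c x y z with
  | some b =>
    have ha : Tetrahedron.ask c x y z k t = k b t := by simp only [Tetrahedron.ask, h]
    rw [ha, hk]
    congr 1
    ext F
    refine and_congr_right fun hF => ?_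
    have hb : F (c, x, y, z) = b := by
      simpa [h, PartialTable.choices] using PartialTable.mem_extensions.1 hF c x y z
    simp only [hb]
  | none =>
    have ha : Tetrahedron.ask c x y z k t =
        k false (t.enter c x y z false) + k true (t.enter c x y z true) := by
      simp only [Tetrahedron.ask, h, branch, enterThen_eq]
    rw [ha, hk, hk, ← Set.ncard_union_eq]
    · congr 1
      ext F
      simp only [Set.mem_union, Set.mem_ofPred_eq, PartialTable.mem_extensions_enter h]
      cases F (c, x, y, z) <;> simp
    · rw [Set.disjoint_left]
      intro F h₁ h₂
      simp only [Set.mem_ofPred_eq, PartialTable.mem_extensions_enter h] at h₁ h₂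
      exact Bool.false_ne_true (h₁.1.2.symm.trans h₂.1.2)

theorem Counts.same {x y : Bool} {k : Counter} {P : (Cell → Bool) → Prop} (hk : Counts k P) :
    Counts (same x y k) fun F => x = y ∧ P F := fun t => by
  cases x <;> cases y <;> simp [Tetrahedron.same, hk t]

/-! The test of the tetrahedron equation at `(x₁, …, x₆)`. The coordinates obtained on the left are
called `uᵢ`, then `lᵢ`; those obtained on the right are called `vᵢ`, then `rᵢ`. The queries are
ordered so that the two sides are compared as early as possible, and cut into short pieces, which
makes them cheap to instantiate during evaluation. -/

/-- Compare the coordinates 1, 2, 3. -/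
noncomputable def compare₁₂₃ (u₁ u₂ u₃ v₁ v₂ v₃ v₄ v₅ v₆ x₄ x₅ x₆ : Bool) (k : Counter) :
    Counter :=
  ask .fst u₁ u₂ u₃ fun l₁ =>
  ask .fst v₁ x₄ x₅ fun r₁ =>
  same l₁ r₁ <|
  ask .snd u₁ u₂ u₃ fun l₂ =>
  ask .fst v₂ v₄ x₆ fun r₂ =>
  same l₂ r₂ <|
  ask .thd u₁ u₂ u₃ fun l₃ =>
  ask .fst v₃ v₅ v₆ fun r₃ =>
  same l₃ r₃ k

/-- Compare the coordinates 5, 1, 2, 3. -/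
noncomputable def compare₅ (u₄ u₅ u₆ v₁ v₂ v₃ v₄ v₅ v₆ x₁ x₂ x₃ x₄ x₅ x₆ : Bool) (k : Counter) :
    Counter :=
  ask .thd x₁ u₄ u₅ fun l₅ =>
  ask .snd v₃ v₅ v₆ fun r₅ =>
  same l₅ r₅ <|
  ask .fst x₁ u₄ u₅ fun u₁ =>
  ask .fst x₂ x₄ u₆ fun u₂ =>
  ask .fst x₃ x₅ x₆ fun u₃ =>
  compare₁₂₃ u₁ u₂ u₃ v₁ v₂ v₃ v₄ v₅ v₆ x₄ x₅ x₆ k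

/-- Compare the coordinates 4, 5, 1, 2, 3. -/
noncomputable def compare₄ (u₆ v₁ v₂ v₃ v₄ v₅ v₆ x₁ x₂ x₃ x₄ x₅ x₆ : Bool) (k : Counter) :
    Counter :=
  ask .snd x₃ x₅ x₆ fun u₅ =>
  ask .snd x₂ x₄ u₆ fun u₄ =>
  ask .snd x₁ u₄ u₅ fun l₄ =>
  ask .snd v₂ v₄ x₆ fun r₄ =>
  same l₄ r₄ <|
  compare₅ u₄ u₅ u₆ v₁ v₂ v₃ v₄ v₅ v₆ x₁ x₂ x₃ x₄ x₅ x₆ k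

/-- Compare the coordinates 6, 4, 5, 1, 2, 3. -/
noncomputable def compare₆ (u₆ l₆ v₁ v₂ v₃ x₁ x₂ x₃ x₄ x₅ x₆ : Bool) (k : Counter) :
    Counter :=
  ask .snd v₁ x₄ x₅ fun v₄ =>
  ask .thd v₁ x₄ x₅ fun v₅ =>
  ask .thd v₂ v₄ x₆ fun v₆ =>
  ask .thd v₃ v₅ v₆ fun r₆ =>
  same l₆ r₆ <|
  compare₄ u₆ v₁ v₂ v₃ v₄ v₅ v₆ x₁ x₂ x₃ x₄ x₅ x₆ k

/-- Test the tetrahedron equation at a point. -/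
noncomputable def equationAt (p : Bool × Bool × Bool × Bool × Bool × Bool) (k : Counter) :
    Counter :=
  match p with
  | (x₁, x₂, x₃, x₄, x₅, x₆) =>
    ask .thd x₃ x₅ x₆ fun u₆ =>
    ask .thd x₂ x₄ u₆ fun l₆ =>
    ask .fst x₁ x₂ x₃ fun v₁ =>
    ask .snd x₁ x₂ x₃ fun v₂ =>
    ask .thd x₁ x₂ x₃ fun v₃ =>
    compare₆ u₆ l₆ v₁ v₂ v₃ x₁ x₂ x₃ x₄ x₅ x₆ k

theorem Counts.equationAt {p : Bool × Bool × Bool × Bool × Bool × Bool} {k : Counter}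
    {P : (Cell → Bool) → Prop} (hk : Counts k P) :
    Counts (equationAt p k) fun F =>
      ((act123 (tableEquiv F) ∘ act145 (tableEquiv F) ∘ act246 (tableEquiv F) ∘
          act356 (tableEquiv F)) p =
        (act356 (tableEquiv F) ∘ act246 (tableEquiv F) ∘ act145 (tableEquiv F) ∘
          act123 (tableEquiv F)) p) ∧ P F := by
  obtain ⟨x₁, x₂, x₃, x₄, x₅, x₆⟩ := p
  have h := Counts.ask (c := .thd) (x := x₃) (y := x₅) (z := x₆) fun u₆ =>
    Counts.ask (c := .thd) (x := x₂) (y := x₄) (z := u₆) fun l₆ =>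
    Counts.ask (c := .fst) (x := x₁) (y := x₂) (z := x₃) fun v₁ =>
    Counts.ask (c := .snd) (x := x₁) (y := x₂) (z := x₃) fun v₂ =>
    Counts.ask (c := .thd) (x := x₁) (y := x₂) (z := x₃) fun v₃ =>
    Counts.ask (c := .snd) (x := v₁) (y := x₄) (z := x₅) fun v₄ =>
    Counts.ask (c := .thd) (x := v₁) (y := x₄) (z := x₅) fun v₅ =>
    Counts.ask (c := .thd) (x := v₂) (y := v₄) (z := x₆) fun v₆ =>
    Counts.ask (c := .thd) (x := v₃) (y := v₅) (z := v₆) fun r₆ =>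
    Counts.same (x := l₆) (y := r₆) <|
    Counts.ask (c := .snd) (x := x₃) (y := x₅) (z := x₆) fun u₅ =>
    Counts.ask (c := .snd) (x := x₂) (y := x₄) (z := u₆) fun u₄ =>
    Counts.ask (c := .snd) (x := x₁) (y := u₄) (z := u₅) fun l₄ =>
    Counts.ask (c := .snd) (x := v₂) (y := v₄) (z := x₆) fun r₄ =>
    Counts.same (x := l₄) (y := r₄) <|
    Counts.ask (c := .thd) (x := x₁) (y := u₄) (z := u₅) fun l₅ =>
    Counts.ask (c := .snd) (x := v₃) (y := v₅) (z := v₆) fun r₅ =>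
    Counts.same (x := l₅) (y := r₅) <|
    Counts.ask (c := .fst) (x := x₁) (y := u₄) (z := u₅) fun u₁ =>
    Counts.ask (c := .fst) (x := x₂) (y := x₄) (z := u₆) fun u₂ =>
    Counts.ask (c := .fst) (x := x₃) (y := x₅) (z := x₆) fun u₃ =>
    Counts.ask (c := .fst) (x := u₁) (y := u₂) (z := u₃) fun l₁ =>
    Counts.ask (c := .fst) (x := v₁) (y := x₄) (z := x₅) fun r₁ =>
    Counts.same (x := l₁) (y := r₁) <|
    Counts.ask (c := .snd) (x := u₁) (y := u₂) (z := u₃) fun l₂ =>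
    Counts.ask (c := .fst) (x := v₂) (y := v₄) (z := x₆) fun r₂ =>
    Counts.same (x := l₂) (y := r₂) <|
    Counts.ask (c := .thd) (x := u₁) (y := u₂) (z := u₃) fun l₃ =>
    Counts.ask (c := .fst) (x := v₃) (y := v₅) (z := v₆) fun r₃ =>
    Counts.same (x := l₃) (y := r₃) hk
  intro t
  rw [Tetrahedron.equationAt]
  refine (h t).trans ?_
  congr 2
  ext F
  simp only [tableEquiv, act123, act145, act246, act356, Function.comp_apply, Equiv.coe_fn_mk,
    Prod.mk.injEq]
  tauto

/-- The points of `Bool⁶`, in an order for which the search tree stays small. -/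
def points : List (Bool × Bool × Bool × Bool × Bool × Bool) :=
  [(false, false, false, false, false, false), (false, false, false, false, false, true),
    (false, false, true, false, false, false), (true, false, false, false, false, false),
    (true, false, false, false, false, true), (false, false, true, false, true, true),
    (true, true, true, false, false, false), (true, true, true, false, false, true),
    (true, false, true, false, false, true), (true, false, true, false, true, true),
    (false, false, true, false, false, true), (true, true, true, false, true, true),
    (true, false, true, false, false, false), (true, true, true, true, true, true),
    (false, true, true, false, true, true), (false, true, true, true, true, true),
    (true, false, false, false, true, true), (false, true, true, false, false, true),
    (false, false, false, true, true, true), (true, false, false, true, true, true),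
    (true, false, true, true, true, true), (true, true, true, false, true, false),
    (true, true, false, false, true, true), (true, true, true, true, true, false),
    (true, true, false, true, false, false), (true, true, false, true, false, true),
    (true, true, false, false, false, true), (false, false, true, false, true, false),
    (false, true, true, true, true, false), (false, false, true, true, false, false),
    (false, true, false, true, true, false), (false, true, false, true, false, true),
    (true, false, false, true, true, false), (false, true, false, false, true, true),
    (true, true, false, false, true, false), (false, false, false, false, true, false),
    (true, true, false, true, true, false), (false, false, true, true, true, false),
    (false, true, true, false, true, false), (false, false, false, true, false, false),
    (false, true, true, false, false, false), (false, false, false, true, false, true),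
    (false, true, false, true, true, true), (true, false, true, true, false, true),
    (true, false, false, true, false, false), (false, false, true, true, false, true),
    (false, true, false, false, true, false), (true, false, true, true, true, false),
    (false, false, true, true, true, true), (false, true, false, false, false, true),
    (false, true, false, true, false, false), (true, false, false, false, true, false),
    (true, false, true, true, false, false), (false, false, false, true, true, false),
    (true, false, true, false, true, false), (true, true, true, true, false, false),
    (true, true, false, false, false, false), (true, false, false, true, false, true),
    (true, true, false, true, true, true), (false, true, true, true, false, false),
    (true, true, true, true, false, true), (false, true, false, false, false, false),
    (false, true, true, true, false, true), (false, false, false, false, true, true)]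

theorem mem_points : ∀ p, p ∈ points := by decide +kernel

/-- Test the tetrahedron equation at a list of points. -/
noncomputable def equationsAt : List (Bool × Bool × Bool × Bool × Bool × Bool) → Counter
  | [] => PartialTable.size
  | p :: l => equationAt p (equationsAt l)

theorem counts_equationsAt (l : List (Bool × Bool × Bool × Bool × Bool × Bool)) :
    Counts (equationsAt l) fun F => ∀ p ∈ l,
      (act123 (tableEquiv F) ∘ act145 (tableEquiv F) ∘ act246 (tableEquiv F) ∘
          act356 (tableEquiv F)) p =
        (act356 (tableEquiv F) ∘ act246 (tableEquiv F) ∘ act145 (tableEquiv F) ∘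
          act123 (tableEquiv F)) p := by
  induction l with
  | nil => simpa only [List.not_mem_nil, false_imp_iff, implies_true] using! counts_size
  | cons p l ih => simpa only [List.forall_mem_cons, equationsAt] using ih.equationAt

theorem counts_points : Counts (equationsAt points) fun F => STTE (tableEquiv F) := by
  convert counts_equationsAt points with F
  rw [STTE, funext_iff]
  refine ⟨fun h p _ => h p, fun h p => h p (mem_points p)⟩

theorem equationsAt_points_blank : equationsAt points .blank = 406 := by
  decide +kernel

theorem ncard_stte_bool :
    {R : Bool × Bool × Bool → Bool × Bool × Bool | STTE R}.ncard = 406 := by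
  rw [← equationsAt_points_blank, counts_points, PartialTable.extensions_blank,
    ← Set.ncard_image_of_injective _ tableEquiv.injective]
  congr 1
  ext R
  obtain ⟨F, rfl⟩ := tableEquiv.surjective R
  simp

end Tetrahedron

theorem stte_count :
    {R : ZMod 2 × ZMod 2 × ZMod 2 → ZMod 2 × ZMod 2 × ZMod 2 | STTE R}.ncard = 406 := by
  let e : Bool ≃ ZMod 2 := finTwoEquiv.symm
  let c := (Tetrahedron.cubeEquiv e).arrowCongr (Tetrahedron.cubeEquiv e)
  rw [← Tetrahedron.ncard_stte_bool, ← Set.ncard_image_of_injective _ c.injective]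
  congr 1
  ext R
  obtain ⟨S, rfl⟩ := c.surjective R
  rw [c.injective.mem_set_image]
  exact Tetrahedron.stte_conj e S
end

section
/- The map R : (ZMod 2)³ → (ZMod 2)³ given by R(x, y, z) = (0, 0, yz + y + z) satisfies the set-theoretic tetrahedron equation. -/
theorem stte_R15 :
    STTE (fun p : ZMod 2 × ZMod 2 × ZMod 2 =>
      ((0 : ZMod 2), (0 : ZMod 2), (p.2.1 * p.2.2 + p.2.1 + p.2.2 : ZMod 2))) := by
  funext ⟨a, b, c, d, e, f⟩
  simp only [act123, act145, act246, act356, Function.comp_apply, mul_zero, zero_mul, zero_add,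
    add_zero, Prod.mk.injEq, true_and]
  ring
end

section
/- The map R : (ZMod 2)³ → (ZMod 2)³ given by R(x, y, z) = (0, x + y, x + z) satisfies the set-theoretic tetrahedron equation. -/
theorem stte_R195 :
    STTE (fun p : ZMod 2 × ZMod 2 × ZMod 2 =>
      ((0 : ZMod 2), (p.1 + p.2.1 : ZMod 2), (p.1 + p.2.2 : ZMod 2))) := by
  funext ⟨a, b, c, d, e, f⟩
  simp only [act123, act145, act246, act356, Function.comp_apply, Prod.mk.injEq]
  grind
end

section
/- The map R : (ZMod 2)³ → (ZMod 2)³ given by R(x, y, z) = (x, yz, yz) satisfies the set-theoretic tetrahedron equation. -/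
theorem stte_R281 :
    STTE (fun p : ZMod 2 × ZMod 2 × ZMod 2 =>
      ((p.1 : ZMod 2), (p.2.1 * p.2.2 : ZMod 2), (p.2.1 * p.2.2 : ZMod 2))) := by
  funext ⟨a, b, c, d, e, f⟩
  have idem (x : ZMod 2) : x * x = x := by revert x; decide
  have h₁ : d * (e * f) * (e * f) = d * (e * f) := by rw [mul_assoc, idem]
  have h₂ : d * e * (d * (e * f)) = d * (e * f) := by rw [← mul_assoc d e f, ← mul_assoc, idem]
  simp only [Function.comp_apply, act123, act145, act246, act356, h₁, h₂, mul_assoc d e f]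
end

section
/- The map R : (ZMod 2)³ → (ZMod 2)³ given by R(x, y, z) = (x, x + z, x + y) satisfies the set-theoretic tetrahedron equation. -/
theorem stte_R389 :
    STTE (fun p : ZMod 2 × ZMod 2 × ZMod 2 =>
      ((p.1 : ZMod 2), (p.1 + p.2.2 : ZMod 2), (p.1 + p.2.1 : ZMod 2))) := by
  funext ⟨a, b, c, d, e, f⟩
  have two_eq_zero : (2 : ZMod 2) = 0 := rfl
  simp only [act123, act145, act246, act356, Function.comp_apply, Prod.mk.injEq]
  refine ⟨trivial, trivial, trivial, ?_, ?_, ?_⟩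
  · ring
  · linear_combination -a * two_eq_zero
  · linear_combination -a * two_eq_zero
end
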